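/- The maps C^i → C^i ⊗ K[X]/(X^2), c ↦ c ⊗ X, and C^i ⊗ K[X]/(X^2) → C^i given by reduction modulo X, are chain maps (C, δ) → (C ⊗ K[X]/(X^2), D) → (C, δ) forming a short exact sequence of cochain complexes; moreover, in the induced maps on cohomology, the image of H^i(C ⊗ K[X]/(X^2), D) → H^i(C, δ) (induced by reduction modulo X) equals ker(ĥ^i : H^i(C) → H^{i+1}(C)), and the kernel of H^i(C, δ) → H^i(C ⊗ K[X]/(X^2), D) (induced by c ↦ c ⊗ X) equals the image of ĥ^{i−1} : H^{i−1}(C) → H^i(C). -/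

import Mathlib

open Polynomial

/-- The twisted differential `δ ⊗ id + h ⊗ (a·)` on `M ⊗_K A`. -/
noncomputable def twD (K : Type*) [CommRing K] {M N A : Type*}
    [AddCommGroup M] [Module K M] [AddCommGroup N] [Module K N]
    [CommRing A] [Algebra K A]
    (δ h : M →ₗ[K] N) (a : A) :
    TensorProduct K M A →ₗ[K] TensorProduct K N A :=
  TensorProduct.map δ (LinearMap.id : A →ₗ[K] A)
    + TensorProduct.map h (LinearMap.mulLeft K a)

/-- The map `M → M ⊗ K[X]/(X^2)`, `c ↦ c ⊗ X`. -/
noncomputable def tensX (K : Type*) [Field K] (M : Type*) [AddCommGroup M] [Module K M] :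
    M →ₗ[K] TensorProduct K M (K[X] ⧸ Ideal.span {(X : K[X]) ^ 2}) :=
  (TensorProduct.mk K M (K[X] ⧸ Ideal.span {(X : K[X]) ^ 2})).flip
    (Ideal.Quotient.mk (Ideal.span {(X : K[X]) ^ 2}) X)

/-- Evaluation at `0`, i.e. reduction modulo `X`, as a `K`-linear map
`K[X]/(X^2) → K`. -/
noncomputable def ev0 (K : Type*) [Field K] :
    (K[X] ⧸ Ideal.span {(X : K[X]) ^ 2}) →ₗ[K] K :=
  (Ideal.Quotient.liftₐ (Ideal.span {(X : K[X]) ^ 2}) (Polynomial.aeval (0 : K)) (by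
    intro a ha
    rw [Ideal.mem_span_singleton] at ha
    obtain ⟨c, rfl⟩ := ha
    simp)).toLinearMap

/-- Reduction modulo `X`, `M ⊗ K[X]/(X^2) → M`. -/
noncomputable def redX (K : Type*) [Field K] (M : Type*) [AddCommGroup M] [Module K M] :
    TensorProduct K M (K[X] ⧸ Ideal.span {(X : K[X]) ^ 2}) →ₗ[K] M :=
  (TensorProduct.rid K M).toLinearMap.comp
    (TensorProduct.map (LinearMap.id : M →ₗ[K] M) (ev0 K))

/-- The coefficient of `X`, as a `K`-linear map `K[X]/(X^2) → K`. -/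
noncomputable def coeffX (K : Type*) [Field K] :
    (K[X] ⧸ Ideal.span {(X : K[X]) ^ 2}) →ₗ[K] K :=
  (TrivSqZeroExt.sndHom K K).comp
    (Ideal.Quotient.liftₐ (Ideal.span {(X : K[X]) ^ 2})
      (Polynomial.aeval (DualNumber.eps : DualNumber K)) (by
        intro a ha
        rw [Ideal.mem_span_singleton] at ha
        obtain ⟨c, rfl⟩ := ha
        simp [pow_two])).toLinearMap

section TruncatedPolynomial

variable (K : Type*) [Field K]

theorem ev0_one : ev0 K 1 = 1 := by
  simp [ev0]

theorem ev0_mk_X : ev0 K (Ideal.Quotient.mk _ X) = 0 := by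
  simp [ev0]

theorem coeffX_one : coeffX K 1 = 0 := by
  simp [coeffX]

theorem coeffX_mk_X : coeffX K (Ideal.Quotient.mk _ X) = 1 := by
  change TrivSqZeroExt.snd (aeval (DualNumber.eps : DualNumber K) X) = 1
  simp

theorem mk_X_mul_mk_X :
    Ideal.Quotient.mk (Ideal.span {(X : K[X]) ^ 2}) X * Ideal.Quotient.mk _ X = 0 := by
  rw [← map_mul, ← pow_two, Ideal.Quotient.eq_zero_iff_mem]
  exact Ideal.mem_span_singleton_self _

theorem exists_eq_smul_one_add_smul_mk_X (a : K[X] ⧸ Ideal.span {(X : K[X]) ^ 2}) :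
    ∃ r s : K, a = r • 1 + s • Ideal.Quotient.mk _ X := by
  obtain ⟨p, rfl⟩ := Ideal.Quotient.mk_surjective a
  refine ⟨p.coeff 0, p.coeff 1, ?_⟩
  change Ideal.Quotient.mk _ p = Ideal.Quotient.mk _ (p.coeff 0 • 1 + p.coeff 1 • X)
  rw [Ideal.Quotient.mk_eq_mk_iff_sub_mem, Ideal.mem_span_singleton, X_pow_dvd_iff]
  intro d hd
  interval_cases d <;> simp [coeff_one, coeff_X]

variable {M N : Type*} [AddCommGroup M] [Module K M] [AddCommGroup N] [Module K N]

theorem exists_eq_tmul_one_add_tensX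
    (w : TensorProduct K M (K[X] ⧸ Ideal.span {(X : K[X]) ^ 2})) :
    ∃ x y : M, w = x ⊗ₜ[K] 1 + tensX K M y := by
  induction w with
  | zero => exact ⟨0, 0, by simp⟩
  | tmul m a =>
    obtain ⟨r, s, rfl⟩ := exists_eq_smul_one_add_smul_mk_X K a
    exact ⟨r • m, s • m, by simp [tensX, TensorProduct.tmul_add, TensorProduct.smul_tmul']⟩
  | add v w hv hw =>
    obtain ⟨x, y, rfl⟩ := hv
    obtain ⟨x', y', rfl⟩ := hw
    exact ⟨x + x', y + y', by rw [TensorProduct.add_tmul, map_add]; abel⟩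

theorem redX_tmul_one_add_tensX (x y : M) :
    redX K M (x ⊗ₜ[K] 1 + tensX K M y) = x := by
  simp [redX, tensX, ev0_one, ev0_mk_X]

theorem tmul_one_add_tensX_inj {x y x' y' : M} :
    x ⊗ₜ[K] 1 + tensX K M y = x' ⊗ₜ[K] 1 + tensX K M y' ↔ x = x' ∧ y = y' := by
  refine ⟨fun e => ⟨?_, ?_⟩, fun ⟨hx, hy⟩ => by rw [hx, hy]⟩
  · simpa only [redX_tmul_one_add_tensX] using congrArg (redX K M) e
  · simpa [tensX, coeffX_one, coeffX_mk_X] using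
      congrArg (TensorProduct.rid K M ∘ TensorProduct.map LinearMap.id (coeffX K)) e

theorem tmul_one_add_tensX_eq_zero {x y : M} :
    x ⊗ₜ[K] 1 + tensX K M y = 0 ↔ x = 0 ∧ y = 0 := by
  simpa using tmul_one_add_tensX_inj K (x := x) (y := y) (x' := 0) (y' := 0)

theorem tmul_one_add_tensX_eq_tensX {x y z : M} :
    x ⊗ₜ[K] 1 + tensX K M y = tensX K M z ↔ x = 0 ∧ y = z := by
  simpa using tmul_one_add_tensX_inj K (x := x) (y := y) (x' := 0) (y' := z)

theorem twD_tmul_one_add_tensX (δ h : M →ₗ[K] N) (x y : M) :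
    twD K δ h (Ideal.Quotient.mk (Ideal.span {(X : K[X]) ^ 2}) X)
        (x ⊗ₜ[K] 1 + tensX K M y) = δ x ⊗ₜ[K] 1 + tensX K N (h x + δ y) := by
  simp [twD, tensX, mk_X_mul_mk_X]
  abel

end TruncatedPolynomial

/-- `c ↦ c ⊗ X` and reduction modulo `X` are chain maps
`(C, δ) → (C ⊗ K[X]/(X^2), D) → (C, δ)` forming a short exact sequence of cochain
complexes; moreover, on cohomology (expressed at the cocycle level, with degree `n+1`,
`n : ℤ` arbitrary), the image of `H^i(C ⊗ K[X]/(X^2)) → H^i(C)` equals `ker ĥ^i`, and the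
kernel of `H^i(C) → H^i(C ⊗ K[X]/(X^2))` equals the image of `ĥ^{i-1}`. -/
theorem transfer_sequence_double_cover
    (K : Type*) [Field K]
    (C : ℤ → Type*) [∀ i, AddCommGroup (C i)] [∀ i, Module K (C i)]
    (δ h : ∀ i : ℤ, C i →ₗ[K] C (i + 1))
    (hδδ : ∀ i : ℤ, (δ (i + 1)).comp (δ i) = 0)
    (hhh : ∀ i : ℤ, (h (i + 1)).comp (h i) = 0)
    (hanti : ∀ i : ℤ, (δ (i + 1)).comp (h i) + (h (i + 1)).comp (δ i) = 0) :
    -- `c ↦ c ⊗ X` is a chain map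
    (∀ i : ℤ,
      (twD K (δ i) (h i) (Ideal.Quotient.mk (Ideal.span {(X : K[X]) ^ 2}) X)).comp
          (tensX K (C i))
        = (tensX K (C (i + 1))).comp (δ i)) ∧
    -- reduction modulo `X` is a chain map
    (∀ i : ℤ,
      (δ i).comp (redX K (C i))
        = (redX K (C (i + 1))).comp
            (twD K (δ i) (h i) (Ideal.Quotient.mk (Ideal.span {(X : K[X]) ^ 2}) X))) ∧
    -- short exactness in each degree
    (∀ i : ℤ, Function.Injective (tensX K (C i)) ∧
      LinearMap.range (tensX K (C i)) = LinearMap.ker (redX K (C i)) ∧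
      Function.Surjective (redX K (C i))) ∧
    -- image of `H^i(C ⊗ K[X]/(X^2)) → H^i(C)` is `ker ĥ^i`
    (∀ (n : ℤ) (z : C (n + 1)), δ (n + 1) z = 0 →
      ((∃ w, twD K (δ (n + 1)) (h (n + 1))
            (Ideal.Quotient.mk (Ideal.span {(X : K[X]) ^ 2}) X) w = 0 ∧
          z - redX K (C (n + 1)) w ∈ LinearMap.range (δ n)) ↔
        h (n + 1) z ∈ LinearMap.range (δ (n + 1)))) ∧
    -- kernel of `H^i(C) → H^i(C ⊗ K[X]/(X^2))` is the image of `ĥ^{i-1}`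
    (∀ (n : ℤ) (z : C (n + 1)), δ (n + 1) z = 0 →
      (tensX K (C (n + 1)) z ∈
          LinearMap.range (twD K (δ n) (h n)
            (Ideal.Quotient.mk (Ideal.span {(X : K[X]) ^ 2}) X)) ↔
        z ∈ Submodule.map (h n) (LinearMap.ker (δ n)) ⊔ LinearMap.range (δ n))) := by
  have anti (i : ℤ) (x : C i) : δ (i + 1) (h i x) + h (i + 1) (δ i x) = 0 :=
    LinearMap.congr_fun (hanti i) x
  refine ⟨fun i => ?_, fun i => ?_, fun i => ⟨?_, ?_, ?_⟩, fun n z hz => ⟨?_, ?_⟩,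
    fun n z hz => ⟨?_, ?_⟩⟩
  · ext x
    simpa using twD_tmul_one_add_tensX K (δ i) (h i) 0 x
  · refine LinearMap.ext fun w => ?_
    obtain ⟨x, y, rfl⟩ := exists_eq_tmul_one_add_tensX K w
    simp only [LinearMap.comp_apply, twD_tmul_one_add_tensX, redX_tmul_one_add_tensX]
  · intro y y' e
    exact ((tmul_one_add_tensX_eq_tensX K (x := 0)).1 (by simpa using e)).2
  · ext w
    obtain ⟨x, y, rfl⟩ := exists_eq_tmul_one_add_tensX K w
    rw [LinearMap.mem_ker, redX_tmul_one_add_tensX]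
    constructor
    · rintro ⟨y', e⟩
      exact ((tmul_one_add_tensX_eq_tensX K).1 e.symm).1
    · rintro rfl
      exact ⟨y, by simp⟩
  · exact fun x => ⟨x ⊗ₜ[K] 1 + tensX K (C i) 0, redX_tmul_one_add_tensX K x 0⟩
  · rintro ⟨w, hw, u, hu⟩
    obtain ⟨x, y, rfl⟩ := exists_eq_tmul_one_add_tensX K w
    rw [twD_tmul_one_add_tensX, tmul_one_add_tensX_eq_zero] at hw
    rw [redX_tmul_one_add_tensX] at hu
    refine ⟨-y - h n u, ?_⟩
    obtain rfl : z = δ n u + x := by rw [hu, sub_add_cancel]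
    rw [map_sub, map_neg, map_add, eq_neg_of_add_eq_zero_left hw.2,
      eq_neg_of_add_eq_zero_right (anti n u)]
    abel
  · rintro ⟨y, hy⟩
    refine ⟨z ⊗ₜ[K] 1 + tensX K _ (-y), ?_, ?_⟩
    · rw [twD_tmul_one_add_tensX, tmul_one_add_tensX_eq_zero]
      exact ⟨hz, by rw [map_neg, hy, add_neg_cancel]⟩
    · rw [redX_tmul_one_add_tensX, sub_self]
      exact zero_mem _
  · rintro ⟨w, hw⟩
    obtain ⟨x, y, rfl⟩ := exists_eq_tmul_one_add_tensX K w
    rw [twD_tmul_one_add_tensX, tmul_one_add_tensX_eq_tensX] at hw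
    exact Submodule.mem_sup.2 ⟨h n x, ⟨x, hw.1, rfl⟩, δ n y, ⟨y, rfl⟩, hw.2⟩
  · intro hmem
    obtain ⟨_, ⟨x, hx, rfl⟩, _, ⟨y, rfl⟩, rfl⟩ := Submodule.mem_sup.1 hmem
    refine ⟨x ⊗ₜ[K] 1 + tensX K _ y, ?_⟩
    rw [twD_tmul_one_add_tensX, tmul_one_add_tensX_eq_tensX]
    exact ⟨hx, rfl⟩
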